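/- In the pair method with N ≥ 3 parties, the variance of the unbiased estimator p̂_i satisfies Var[p̂_i] = (1/n) p_i (1 − p_i) + (1/(n(N−2))) (1 − p_i); in particular, if 0 < p_i < 1 then Var[p̂_i] > (1/n) p_i (1 − p_i), the variance of the direct-response binomial estimator based on the same sample size n. -/

import Mathlib

open Matrix

/-- The probability mass function of the multinomial distribution `Mult(n, u)`:
the distribution of the vector of category counts of `n` i.i.d. categorical
random variables with probability vector `u`. -/
noncomputable def multinomialPMF {ι : Type*} [Fintype ι] (n : ℕ) (u : ι → ℝ)
    (x : ι → ℕ) : ℝ :=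
  if (∑ i, x i) = n then
    (n.factorial : ℝ) / (∏ i, ((x i).factorial : ℝ)) * ∏ i, u i ^ x i
  else 0

/-- The index type of unordered pairs of distinct parties (the possible responses in
the pair method), realized as two-element subsets of `Fin N`. -/
abbrev PairIdx (N : ℕ) := {s : Finset (Fin N) // s.card = 2}

/-- In the pair method the probability of the response `{i,j}` is
`u_{ij} = (p_i + p_j)/(N−1)`. -/
noncomputable def pairU (N : ℕ) (p : Fin N → ℝ) (s : PairIdx N) : ℝ :=
  (∑ k ∈ s.1, p k) / ((N : ℝ) - 1)

/-- The pair-method estimator `p̂_i = ((N−1)/(N−2)) Σ_{j≠i} û_{{i,j}} − 1/(N−2)`,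
where `û = X/n` and the sum runs over all pairs containing `i`. -/
noncomputable def pairPhat (N : ℕ) (n : ℕ) (x : PairIdx N → ℕ) (i : Fin N) : ℝ :=
  ((N : ℝ) - 1) / ((N : ℝ) - 2) *
      (∑ s : PairIdx N, if i ∈ s.1 then (x s : ℝ) / (n : ℝ) else 0) -
    1 / ((N : ℝ) - 2)


open Finset Polynomial in
/-- The probability generating function of the total count `∑ s ∈ T, x s` of a set `T` of
categories under the multinomial distribution. -/
theorem sum_multinomialPMF_mul_X_pow {ι : Type*} [Fintype ι] [DecidableEq ι] (n : ℕ) (u : ι → ℝ)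
    (T : Finset ι) :
    ∑ x ∈ piAntidiag univ n, C (multinomialPMF n u x) * (X : ℝ[X]) ^ (∑ s ∈ T, x s) =
      (C (∑ s ∈ T, u s) * X + C (∑ s ∈ Tᶜ, u s)) ^ n := by
  have hbase : C (∑ s ∈ T, u s) * (X : ℝ[X]) + C (∑ s ∈ Tᶜ, u s) =
      ∑ s, C (u s) * (if s ∈ T then X else 1) := by
    rw [← Finset.sum_add_sum_compl T, map_sum, map_sum, Finset.sum_mul]
    congr 1
    · exact Finset.sum_congr rfl fun s hs => by simp [hs]
    · exact Finset.sum_congr rfl fun s hs => by simp [Finset.mem_compl.mp hs]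
  rw [hbase, Finset.sum_pow_eq_sum_piAntidiag]
  refine Finset.sum_congr rfl fun x hx => ?_
  have hsum : ∑ i, x i = n := (mem_piAntidiag.mp hx).1
  have hcoef : (n.factorial : ℝ) / ∏ i, ((x i).factorial : ℝ) = Nat.multinomial univ x := by
    have hne : (∏ i, ((x i).factorial : ℝ)) ≠ 0 :=
      Finset.prod_ne_zero_iff.mpr fun i _ => by positivity
    rw [div_eq_iff hne, mul_comm, ← hsum, ← Nat.multinomial_spec univ x]
    push_cast
    rfl
  have hX : ∏ i, (if i ∈ T then (X : ℝ[X]) else 1) ^ x i = X ^ (∑ s ∈ T, x s) := by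
    simp only [ite_pow, one_pow, Finset.prod_ite_mem, Finset.univ_inter,
      Finset.prod_pow_eq_pow_sum]
  simp only [multinomialPMF, if_pos hsum, hcoef, mul_pow, Finset.prod_mul_distrib, hX,
    map_mul, map_prod, map_pow, map_natCast, mul_assoc]

open Finset Polynomial in
/-- The second moment about an arbitrary affine centre of the total count of a set of categories
under the multinomial distribution. -/
theorem tsum_multinomialPMF_mul_sq {ι : Type*} [Fintype ι] (n : ℕ) (u : ι → ℝ)
    (hu : ∑ s, u s = 1) (T : Finset ι) (a b : ℝ) :
    ∑' x : ι → ℕ, multinomialPMF n u x * (a * (∑ s ∈ T, (x s : ℝ)) + b) ^ 2 =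
      a ^ 2 * (n * (n - 1) * (∑ s ∈ T, u s) ^ 2) +
        (a ^ 2 + 2 * a * b) * (n * ∑ s ∈ T, u s) + b ^ 2 := by
  classical
  have hpgf := sum_multinomialPMF_mul_X_pow n u T
  have hq : ∑ s ∈ T, u s + ∑ s ∈ Tᶜ, u s = 1 := by rw [Finset.sum_add_sum_compl, hu]
  have h0 := congrArg (eval 1) hpgf
  have h1 := congrArg (fun f => eval 1 (derivative f)) hpgf
  have h2 := congrArg (fun f => eval 1 (derivative (derivative f))) hpgf
  set q := ∑ s ∈ T, u s
  have hcast (k : ℕ) : (k : ℝ) * ((k - 1 : ℕ) : ℝ) = k * (k - 1) := by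
    cases k <;> simp
  simp [eval_finsetSum, derivative_pow, hq] at h0 h1 h2
  rw [tsum_eq_sum (s := piAntidiag univ n)]
  · have h2' : ∑ x ∈ piAntidiag univ n, multinomialPMF n u x *
        ((∑ s ∈ T, (x s : ℝ)) * ((∑ s ∈ T, (x s : ℝ)) - 1)) = n * (n - 1) * q ^ 2 := by
      rw [← hcast n]
      refine (Finset.sum_congr rfl fun x _ => ?_).trans (h2.trans (by ring))
      rw [← Nat.cast_sum, hcast]
    have hsplit (x : ι → ℕ) :
        multinomialPMF n u x * (a * (∑ s ∈ T, (x s : ℝ)) + b) ^ 2 =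
          a ^ 2 * (multinomialPMF n u x *
              ((∑ s ∈ T, (x s : ℝ)) * ((∑ s ∈ T, (x s : ℝ)) - 1))) +
            (a ^ 2 + 2 * a * b) * (multinomialPMF n u x * ∑ s ∈ T, (x s : ℝ)) +
            b ^ 2 * multinomialPMF n u x := by
      ring
    rw [Finset.sum_congr rfl fun x _ => hsplit x, Finset.sum_add_distrib,
      Finset.sum_add_distrib, ← Finset.mul_sum, ← Finset.mul_sum, ← Finset.mul_sum, h2', h1, h0,
      mul_one]
  · intro x hx
    have hsum : ∑ i, x i ≠ n := fun h => hx (mem_piAntidiag.mpr ⟨h, by simp⟩)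
    simp [multinomialPMF, hsum]

/-- Summing over the pairs containing `i` amounts to summing over the other element. -/
theorem sum_pairIdx_mem {N : ℕ} (i : Fin N) (g : Finset (Fin N) → ℝ) :
    ∑ s : PairIdx N, (if i ∈ s.1 then g s.1 else 0) = ∑ j ∈ Finset.univ.erase i, g {i, j} := by
  rw [← Finset.sum_filter]
  symm
  refine Finset.sum_bij
    (fun j hj => ⟨{i, j}, Finset.card_pair (Finset.ne_of_mem_erase hj).symm⟩) ?_ ?_ ?_ ?_
  · intro j hj
    simp
  · intro j hj k hk h
    have hmem : j ∈ ({i, k} : Finset (Fin N)) := by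
      rw [← Subtype.mk.inj h]
      simp
    simpa [Finset.ne_of_mem_erase hj] using hmem
  · rintro ⟨s, hs⟩ hi
    have his : i ∈ s := by simpa using hi
    obtain ⟨a, b, hab, rfl⟩ := Finset.card_eq_two.mp hs
    rcases Finset.mem_insert.mp his with rfl | hb
    · exact ⟨b, by simpa using hab.symm, rfl⟩
    · obtain rfl := Finset.mem_singleton.mp hb
      exact ⟨a, by simpa using hab, Subtype.ext (Finset.pair_comm _ _)⟩
  · intro j hj
    rfl

/-- The probability that the reported pair contains party `i`. -/
theorem sum_pairU_mem {N : ℕ} (hN : 3 ≤ N) (p : Fin N → ℝ) (hp : ∑ i, p i = 1) (i : Fin N) :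
    ∑ s : PairIdx N with i ∈ s.1, pairU N p s =
      (((N : ℝ) - 2) * p i + 1) / ((N : ℝ) - 1) := by
  have hsum : ∑ j ∈ Finset.univ.erase i, p j = 1 - p i := by
    rw [← hp, ← Finset.add_sum_erase _ _ (Finset.mem_univ i)]
    ring
  have hpair : ∀ j ∈ Finset.univ.erase i, ∑ k ∈ ({i, j} : Finset (Fin N)), p k = p i + p j :=
    fun j hj => Finset.sum_pair (Finset.ne_of_mem_erase hj).symm
  simp only [pairU]
  rw [← Finset.sum_div, Finset.sum_filter, sum_pairIdx_mem i fun s => ∑ k ∈ s, p k,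
    Finset.sum_congr rfl hpair, Finset.sum_add_distrib, hsum, Finset.sum_const,
    Finset.card_erase_of_mem (Finset.mem_univ i), Finset.card_univ, Fintype.card_fin,
    nsmul_eq_mul, Nat.cast_sub (by omega)]
  push_cast
  ring

/-- The response probabilities of the pair method sum to one. -/
theorem sum_pairU {N : ℕ} (hN : 3 ≤ N) (p : Fin N → ℝ) (hp : ∑ i, p i = 1) :
    ∑ s, pairU N p s = 1 := by
  have hN' : (3 : ℝ) ≤ N := by exact_mod_cast hN
  have hcount (k : Fin N) : ∑ s : PairIdx N, (if k ∈ s.1 then p k else 0) =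
      ((N : ℝ) - 1) * p k := by
    rw [sum_pairIdx_mem k fun _ => p k, Finset.sum_const,
      Finset.card_erase_of_mem (Finset.mem_univ k), Finset.card_univ, Fintype.card_fin,
      nsmul_eq_mul, Nat.cast_sub (by omega), Nat.cast_one]
  have hmem (s : PairIdx N) : ∑ k ∈ s.1, p k = ∑ k, if k ∈ s.1 then p k else 0 := by
    simp
  simp only [pairU]
  rw [← Finset.sum_div, Finset.sum_congr rfl fun s _ => hmem s, Finset.sum_comm,
    Finset.sum_congr rfl fun k _ => hcount k, ← Finset.mul_sum, hp, mul_one,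
    div_self (by linarith)]

/-- in the pair method with `N ≥ 3` parties, the variance of the unbiased
estimator `p̂_i` satisfies
`Var[p̂_i] = (1/n) p_i (1 − p_i) + (1/(n(N−2))) (1 − p_i)`; in particular, if
`0 < p_i < 1` then `Var[p̂_i] > (1/n) p_i (1 − p_i)`, the variance of the
direct-response binomial estimator based on the same sample size `n`. -/
theorem statement7 (N : ℕ) (hN : 3 ≤ N) (p : Fin N → ℝ)
    (hp0 : ∀ i, 0 ≤ p i) (hp1 : ∑ i, p i = 1) (n : ℕ) (hn : 0 < n) :
    ∀ i : Fin N,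
      (∑' x : PairIdx N → ℕ,
          multinomialPMF n (pairU N p) x * (pairPhat N n x i - p i) ^ 2) =
        (1 / (n : ℝ)) * p i * (1 - p i) + (1 / ((n : ℝ) * ((N : ℝ) - 2))) * (1 - p i) ∧
      (0 < p i → p i < 1 →
        (1 / (n : ℝ)) * p i * (1 - p i) <
          ∑' x : PairIdx N → ℕ,
            multinomialPMF n (pairU N p) x * (pairPhat N n x i - p i) ^ 2) := by
  intro i
  have hN' : (3 : ℝ) ≤ N := by exact_mod_cast hN
  have hn' : (0 : ℝ) < n := by exact_mod_cast hn
  have hN1 : (N : ℝ) - 1 ≠ 0 := by linarith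
  have hN2 : (0 : ℝ) < (N : ℝ) - 2 := by linarith
  have hvar : ∑' x : PairIdx N → ℕ,
      multinomialPMF n (pairU N p) x * (pairPhat N n x i - p i) ^ 2 =
        (1 / (n : ℝ)) * p i * (1 - p i) + (1 / ((n : ℝ) * ((N : ℝ) - 2))) * (1 - p i) := by
    have hphat (x : PairIdx N → ℕ) : pairPhat N n x i - p i =
        ((N : ℝ) - 1) / ((N : ℝ) - 2) / n * (∑ s : PairIdx N with i ∈ s.1, (x s : ℝ)) +
          (-(1 / ((N : ℝ) - 2)) - p i) := by
      rw [pairPhat, ← Finset.sum_filter, ← Finset.sum_div]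
      ring
    simp only [hphat]
    rw [tsum_multinomialPMF_mul_sq n _ (sum_pairU hN p hp1), sum_pairU_mem hN p hp1]
    field_simp
    ring
  refine ⟨hvar, fun _ hlt => ?_⟩
  rw [hvar]
  have hpos : 0 < 1 / ((n : ℝ) * ((N : ℝ) - 2)) * (1 - p i) :=
    mul_pos (by positivity) (by linarith)
  linarith
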